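/- Let k be a field and R = k[x₁,x₂,x₃]/(x₁x₂, x₁x₃). The injective dimension of R as a module over itself is infinite. Specifically, Ext^i_R(R/(x₁), R) ≠ 0 for infinitely many i > 0. -/

import Mathlib

open MvPolynomial

noncomputable section

/-- The ideal `(x₁x₂, x₁x₃)` of `k[x₁,x₂,x₃]`. -/
def I3 (k : Type*) [Field k] : Ideal (MvPolynomial (Fin 3) k) :=
  Ideal.span {X 0 * X 1, X 0 * X 2}

/-- The ring `R = k[x₁,x₂,x₃]/(x₁x₂, x₁x₃)`. -/
abbrev R3 (k : Type*) [Field k] := MvPolynomial (Fin 3) k ⧸ I3 k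

instance (k : Type*) [Field k] : Module (R3 k) (R3 k) := Semiring.toModule

/-- The image of the variable `xᵢ` in `R3 k`. -/
def v3 (k : Type*) [Field k] (i : Fin 3) : R3 k := Ideal.Quotient.mk (I3 k) (X i)

open CategoryTheory

section ExtGeneral

universe u

/-- Nontriviality of derived-category `Ext` in positive degree gives nontriviality of the
`Ext` defined by left deriving the linear Yoneda functor. -/
lemma nontrivial_ext_succ_of_abelian {R : Type u} [CommRing R] (X Y : ModuleCat.{u} R) (n : ℕ)
    (h : Nontrivial (Abelian.Ext X Y (n + 1))) :
    Nontrivial (((Ext R (ModuleCat.{u} R) (n + 1)).obj (Opposite.op X)).obj Y) := by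
  by_contra hs
  rw [not_nontrivial_iff_subsingleton] at hs
  let P := ProjectiveResolution.of X
  have hz : Limits.IsZero ((P.complex.linearYonedaObj R Y).homology (n + 1)) :=
    (ModuleCat.isZero_of_subsingleton _).of_iso (P.isoExt (R := R) (n + 1) Y).symm
  rw [← HomologicalComplex.exactAt_iff_isZero_homology,
    HomologicalComplex.exactAt_iff' _ n (n + 1) (n + 2) (by simp) (by simp),
    ShortComplex.moduleCat_exact_iff] at hz
  obtain ⟨α, hα⟩ := exists_ne (0 : Abelian.Ext X Y (n + 1))
  obtain ⟨f, hf, rfl⟩ := P.extMk_surjective α (n + 2) rfl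
  refine hα ((P.extMk_eq_zero_iff f (n + 2) rfl hf n rfl).2 ?_)
  exact hz f hf

variable {R : Type u} [CommRing R] {K P M : Type u} [AddCommGroup K] [AddCommGroup P]
  [AddCommGroup M] [Module R K] [Module R P] [Module R M] (Y : ModuleCat.{u} R)

lemma shortExact_moduleCat_mk {i : K →ₗ[R] P} {f : P →ₗ[R] M} (hi : Function.Injective i)
    (hf : Function.Surjective f) (h : Function.Exact i f) :
    (ShortComplex.mk (ModuleCat.ofHom i) (ModuleCat.ofHom f)
      (by ext x; exact h.apply_apply_eq_zero x)).ShortExact :=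
  ModuleCat.shortComplex_shortExact _ h hi hf

/-- Dimension shifting along a short exact sequence with projective middle term. -/
lemma nontrivial_ext_of_syzygy [Module.Projective R P] {i : K →ₗ[R] P} {f : P →ₗ[R] M}
    (hi : Function.Injective i)
    (hf : Function.Surjective f) (h : Function.Exact i f) (n : ℕ)
    (hK : Nontrivial (Abelian.Ext (ModuleCat.of R K) Y (n + 1))) :
    Nontrivial (Abelian.Ext (ModuleCat.of R M) Y (n + 2)) := by
  have hS := shortExact_moduleCat_mk hi hf h
  by_contra hs
  rw [not_nontrivial_iff_subsingleton] at hs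
  obtain ⟨α, hα⟩ := exists_ne (0 : Abelian.Ext (ModuleCat.of R K) Y (n + 1))
  obtain ⟨β, hβ⟩ := Abelian.Ext.contravariant_sequence_exact₁ hS Y α
    (n₁ := n + 2) (by omega) (Subsingleton.elim (α := Abelian.Ext (ModuleCat.of R M) Y (n + 2)) _ _)
  have : Projective (ModuleCat.of R P) := ModuleCat.projective_of_categoryTheory_projective _
  have hβ0 : β = 0 := Abelian.Ext.eq_zero_of_projective β
  apply hα
  rw [← hβ, hβ0, Abelian.Ext.comp_zero]

/-- If `Ext¹(M, Y)` vanishes, maps to `Y` extend along an injection with cokernel `M`. -/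
lemma exists_extension_of_subsingleton_ext_one {i : K →ₗ[R] P} {f : P →ₗ[R] M}
    (hi : Function.Injective i)
    (hf : Function.Surjective f) (h : Function.Exact i f)
    (hM : Subsingleton (Abelian.Ext (ModuleCat.of R M) Y 1)) (g : K →ₗ[R] Y) :
    ∃ g' : P →ₗ[R] Y, g' ∘ₗ i = g := by
  have hS := shortExact_moduleCat_mk hi hf h
  obtain ⟨β, hβ⟩ := Abelian.Ext.contravariant_sequence_exact₁ hS Y
    (Abelian.Ext.mk₀ (ModuleCat.ofHom g))
    (n₁ := 1) rfl (Subsingleton.elim (α := Abelian.Ext (ModuleCat.of R M) Y 1) _ _)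
  obtain ⟨g', rfl⟩ := (Abelian.Ext.mk₀_bijective _ _).2 β
  rw [Abelian.Ext.mk₀_comp_mk₀] at hβ
  have := (Abelian.Ext.mk₀_bijective _ _).1 hβ
  exact ⟨g'.hom, congrArg ModuleCat.Hom.hom this⟩

lemma nontrivial_ext_of_retract {r : P →ₗ[R] M} {s : M →ₗ[R] P} (h : r ∘ₗ s = LinearMap.id)
    (n : ℕ) (hM : Nontrivial (Abelian.Ext (ModuleCat.of R M) Y n)) :
    Nontrivial (Abelian.Ext (ModuleCat.of R P) Y n) := by
  obtain ⟨α, hα⟩ := exists_ne (0 : Abelian.Ext (ModuleCat.of R M) Y n)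
  refine nontrivial_of_ne ((Abelian.Ext.mk₀ (ModuleCat.ofHom r)).comp α (zero_add n)) 0 ?_
  intro h0
  have h1 := congrArg (fun β ↦ (Abelian.Ext.mk₀ (ModuleCat.ofHom s)).comp β (zero_add n)) h0
  simp only [Abelian.Ext.mk₀_comp_mk₀_assoc, ← ModuleCat.ofHom_comp, h, Abelian.Ext.comp_zero] at h1
  exact hα (by simpa using h1)

end ExtGeneral

section Ring

variable (k : Type*) [Field k]

lemma v3_zero_mul_one : v3 k 0 * v3 k 1 = 0 := by
  rw [v3, v3, ← map_mul]
  exact Ideal.Quotient.eq_zero_iff_mem.2 (Ideal.subset_span (by simp))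

lemma v3_zero_mul_two : v3 k 0 * v3 k 2 = 0 := by
  rw [v3, v3, ← map_mul]
  exact Ideal.Quotient.eq_zero_iff_mem.2 (Ideal.subset_span (by simp))

/-- The ring homomorphism out of `R3 k` sending `xᵢ` to `g i`. -/
def R3.lift {B : Type*} [CommRing B] [Algebra k B] (g : Fin 3 → B) (h₁ : g 0 * g 1 = 0)
    (h₂ : g 0 * g 2 = 0) : R3 k →+* B :=
  Ideal.Quotient.lift (I3 k) (aeval g : MvPolynomial (Fin 3) k →ₐ[k] B).toRingHom (by
    change I3 k ≤ RingHom.ker (aeval g : MvPolynomial (Fin 3) k →ₐ[k] B).toRingHom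
    rw [I3, Ideal.span_le]
    rintro _ (rfl | rfl) <;> simp [RingHom.mem_ker, h₁, h₂])

/-- Setting `x₁ = 0`. -/
def killFst : R3 k →+* MvPolynomial (Fin 3) k :=
  R3.lift k ![0, X 1, X 2] (by simp) (by simp)

/-- Setting `x₂ = x₃ = 0`. -/
def killRest : R3 k →+* MvPolynomial (Fin 3) k :=
  R3.lift k ![X 0, 0, 0] (by simp) (by simp)

@[simp] lemma killFst_mk (p : MvPolynomial (Fin 3) k) :
    killFst k (Ideal.Quotient.mk (I3 k) p) = aeval ![0, X 1, X 2] p := rfl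

@[simp] lemma killRest_mk (p : MvPolynomial (Fin 3) k) :
    killRest k (Ideal.Quotient.mk (I3 k) p) = aeval ![X 0, 0, 0] p := rfl

@[simp] lemma killFst_zero : killFst k (v3 k 0) = 0 := by simp [v3]
@[simp] lemma killFst_one : killFst k (v3 k 1) = X 1 := by simp [v3]
@[simp] lemma killFst_two : killFst k (v3 k 2) = X 2 := by simp [v3]
@[simp] lemma killRest_zero : killRest k (v3 k 0) = X 0 := by simp [v3]

/-- Replacing each variable by a polynomial congruent to it modulo `J` does not change a
polynomial modulo `J`. -/
lemma sub_aeval_mem {σ : Type*} (J : Ideal (MvPolynomial σ k)) (g : σ → MvPolynomial σ k)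
    (h : ∀ i, X i - g i ∈ J) (p : MvPolynomial σ k) : p - aeval g p ∈ J := by
  rw [← Ideal.Quotient.eq]
  have : (Ideal.Quotient.mkₐ k J) = (Ideal.Quotient.mkₐ k J).comp (aeval g) := by
    ext i
    simpa using Ideal.Quotient.eq.2 (h i)
  exact DFunLike.congr_fun this p

lemma mk_killFst (a : R3 k) :
    a - Ideal.Quotient.mk (I3 k) (killFst k a) ∈ Ideal.span {v3 k 0} := by
  obtain ⟨p, rfl⟩ := Ideal.Quotient.mk_surjective a
  have h := sub_aeval_mem k (Ideal.span {X 0}) ![0, X 1, X 2] (by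
    intro i
    fin_cases i <;> simp) p
  have := Ideal.mem_map_of_mem (Ideal.Quotient.mk (I3 k)) h
  rwa [Ideal.map_span, Set.image_singleton, map_sub] at this

lemma mk_killRest (a : R3 k) :
    a - Ideal.Quotient.mk (I3 k) (killRest k a) ∈ Ideal.span {v3 k 1, v3 k 2} := by
  obtain ⟨p, rfl⟩ := Ideal.Quotient.mk_surjective a
  have h := sub_aeval_mem k (Ideal.span {X 1, X 2}) ![X 0, 0, 0] (by
    intro i
    fin_cases i
    · simp
    · simpa using Ideal.subset_span (by simp)
    · simpa using Ideal.subset_span (by simp)) p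
  have := Ideal.mem_map_of_mem (Ideal.Quotient.mk (I3 k)) h
  rwa [Ideal.map_span, Set.image_pair, map_sub] at this

variable {k}

lemma killRest_eq_zero {a : R3 k} (h : v3 k 0 * a = 0) : killRest k a = 0 := by
  simpa [X_ne_zero] using congrArg (killRest k) h

lemma mem_span_of_v3_mul_eq_zero {a : R3 k} (h : v3 k 0 * a = 0) :
    a ∈ Ideal.span {v3 k 1, v3 k 2} := by
  simpa [killRest_eq_zero h] using mk_killRest k a

lemma constantCoeff_killFst (a : R3 k) :
    constantCoeff (killFst k a) = constantCoeff (killRest k a) := by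
  obtain ⟨p, rfl⟩ := Ideal.Quotient.mk_surjective a
  rw [killFst_mk, killRest_mk]
  induction p using MvPolynomial.induction_on with
  | C a => simp
  | add p q hp hq => simp only [map_add, hp, hq]
  | mul_X p i hp => fin_cases i <;> simp

/-- In `k[x₁,x₂,x₃]`, syzygies of `(x₂, x₃)` are multiples of `(x₃, -x₂)`. -/
lemma exists_koszul {a b : MvPolynomial (Fin 3) k} (h : a * X 1 + b * X 2 = 0) :
    ∃ c : MvPolynomial (Fin 3) k, a = c * X 2 ∧ b = -(c * X 1) := by
  have hd : (X 2 : MvPolynomial (Fin 3) k) ∣ a * X 1 := ⟨-b, by linear_combination h⟩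
  have hp : Prime (X 2 : MvPolynomial (Fin 3) k) := X_prime
  have hn : ¬ (X 2 : MvPolynomial (Fin 3) k) ∣ X 1 := by
    rw [X_dvd_X]; simp
  obtain ⟨c, rfl⟩ := (hp.dvd_or_dvd hd).resolve_right hn
  refine ⟨c, mul_comm _ _, mul_left_cancel₀ hp.ne_zero ?_⟩
  linear_combination h

end Ring

section Syzygies

variable (k : Type*) [Field k]

/-- Multiplication by `x₁`, with values in the ideal `(x₁)`. -/
def mulFst : R3 k →ₗ[R3 k] Ideal.span {v3 k 0} :=
  (LinearMap.toSpanSingleton (R3 k) (R3 k) (v3 k 0)).codRestrict _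
    fun a ↦ Ideal.mul_mem_left _ a (Ideal.mem_span_singleton_self _)

@[simp] lemma coe_mulFst (a : R3 k) : (mulFst k a : R3 k) = a * v3 k 0 := rfl

lemma mulFst_surjective : Function.Surjective (mulFst k) := by
  rintro ⟨a, ha⟩
  obtain ⟨c, rfl⟩ := Ideal.mem_span_singleton'.1 ha
  exact ⟨c, rfl⟩

lemma mem_span_iff {a : R3 k} : a ∈ Ideal.span {v3 k 1, v3 k 2} ↔ a * v3 k 0 = 0 := by
  refine ⟨fun h ↦ ?_, fun h ↦ mem_span_of_v3_mul_eq_zero (by rwa [mul_comm])⟩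
  obtain ⟨c, d, rfl⟩ := Ideal.mem_span_pair.1 h
  linear_combination c * v3_zero_mul_one k + d * v3_zero_mul_two k

lemma exact_mulFst :
    Function.Exact (Submodule.subtype (Ideal.span {v3 k 1, v3 k 2})) (mulFst k) := by
  intro a
  rw [← Subtype.coe_inj, coe_mulFst, Submodule.coe_zero, ← mem_span_iff]
  simp

/-- The map `(a, b) ↦ a x₂ + b x₃`, with values in the ideal `(x₂, x₃)`. -/
def combine : R3 k × R3 k →ₗ[R3 k] Ideal.span {v3 k 1, v3 k 2} :=
  ((LinearMap.toSpanSingleton (R3 k) (R3 k) (v3 k 1)).coprod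
    (LinearMap.toSpanSingleton (R3 k) (R3 k) (v3 k 2))).codRestrict _
      fun a ↦ Ideal.mem_span_pair.2 ⟨a.1, a.2, rfl⟩

@[simp] lemma coe_combine (w : R3 k × R3 k) :
    (combine k w : R3 k) = w.1 * v3 k 1 + w.2 * v3 k 2 := rfl

lemma combine_surjective : Function.Surjective (combine k) := by
  rintro ⟨a, ha⟩
  obtain ⟨c, d, rfl⟩ := Ideal.mem_span_pair.1 ha
  exact ⟨(c, d), rfl⟩

lemma mem_ker_combine {w : R3 k × R3 k} :
    w ∈ LinearMap.ker (combine k) ↔ w.1 * v3 k 1 + w.2 * v3 k 2 = 0 := by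
  rw [LinearMap.mem_ker, ← Subtype.coe_inj, coe_combine, Submodule.coe_zero]

/-- The element `(x₃, -x₂)` of the kernel of `combine`. -/
def koszulElt : LinearMap.ker (combine k) :=
  ⟨(v3 k 2, -v3 k 1), (mem_ker_combine k).2 (by ring)⟩

lemma v3_zero_smul_koszulElt : v3 k 0 • koszulElt k = 0 :=
  Subtype.ext (Prod.ext (v3_zero_mul_two k) (by
    change v3 k 0 * -v3 k 1 = 0
    linear_combination -v3_zero_mul_one k))

/-- The inclusion of `R/(x₁)` as the submodule generated by `(x₃, -x₂)`. -/
def koszulIncl : (R3 k ⧸ Ideal.span {v3 k 0}) →ₗ[R3 k] LinearMap.ker (combine k) :=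
  Submodule.liftQ _ (LinearMap.toSpanSingleton (R3 k) _ (koszulElt k)) (by
    rw [Ideal.span, Submodule.span_le, Set.singleton_subset_iff]
    exact v3_zero_smul_koszulElt k)

@[simp] lemma koszulIncl_mk (a : R3 k) :
    koszulIncl k (Submodule.Quotient.mk a) = a • koszulElt k := rfl

lemma exists_koszul_coeff (w : LinearMap.ker (combine k)) :
    ∃ c : MvPolynomial (Fin 3) k, killFst k w.1.1 = c * X 2 ∧ killFst k w.1.2 = -(c * X 1) := by
  apply exists_koszul
  simpa using congrArg (killFst k) ((mem_ker_combine k).1 w.2)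

/-- The polynomial `c` such that `w = c (x₃, -x₂)` after setting `x₁ = 0`. -/
def koszulCoeff (w : LinearMap.ker (combine k)) : MvPolynomial (Fin 3) k :=
  (exists_koszul_coeff k w).choose

lemma koszulCoeff_mul (w : LinearMap.ker (combine k)) :
    koszulCoeff k w * X 2 = killFst k w.1.1 :=
  (exists_koszul_coeff k w).choose_spec.1.symm

lemma koszulCoeff_eq {w : LinearMap.ker (combine k)} {c : MvPolynomial (Fin 3) k}
    (h : killFst k w.1.1 = c * X 2) : koszulCoeff k w = c :=
  mul_right_cancel₀ (X_ne_zero 2) ((koszulCoeff_mul k w).trans h)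

lemma mk_killFst_quotient (a : R3 k) :
    (Submodule.Quotient.mk (Ideal.Quotient.mk (I3 k) (killFst k a)) :
      R3 k ⧸ Ideal.span {v3 k 0}) = Submodule.Quotient.mk a :=
  ((Submodule.Quotient.eq _).2 (mk_killFst k a)).symm

/-- The retraction of the kernel of `combine` onto `R/(x₁)`. -/
def koszulRetract : LinearMap.ker (combine k) →ₗ[R3 k] (R3 k ⧸ Ideal.span {v3 k 0}) where
  toFun w := Submodule.Quotient.mk (Ideal.Quotient.mk (I3 k) (koszulCoeff k w))
  map_add' w w' := by
    rw [koszulCoeff_eq k (w := w + w') (c := koszulCoeff k w + koszulCoeff k w')]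
    · simp
    · simp [add_mul, koszulCoeff_mul]
  map_smul' a w := by
    rw [koszulCoeff_eq k (w := a • w) (c := killFst k a * koszulCoeff k w)]
    · rw [map_mul, mul_comm, ← smul_eq_mul, Submodule.Quotient.mk_smul, mk_killFst_quotient,
        ← Submodule.Quotient.mk_smul, smul_eq_mul, mul_comm, ← smul_eq_mul,
        Submodule.Quotient.mk_smul, RingHom.id_apply]
    · simp [mul_assoc, koszulCoeff_mul]

lemma koszulRetract_koszulElt : koszulRetract k (koszulElt k) = Submodule.Quotient.mk 1 := by
  change Submodule.Quotient.mk (Ideal.Quotient.mk (I3 k) (koszulCoeff k (koszulElt k))) = _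
  rw [koszulCoeff_eq k (c := 1) (by simp [koszulElt]), map_one]

lemma koszulRetract_comp_koszulIncl : koszulRetract k ∘ₗ koszulIncl k = LinearMap.id := by
  refine LinearMap.ext fun q ↦ ?_
  obtain ⟨a, rfl⟩ := Submodule.Quotient.mk_surjective _ q
  rw [LinearMap.comp_apply, koszulIncl_mk, map_smul, koszulRetract_koszulElt,
    ← Submodule.Quotient.mk_smul, smul_eq_mul, mul_one, LinearMap.id_apply]

/-- Multiplication by `x₂` as a map `R/(x₁) → R`. -/
def mulSndQuot : (R3 k ⧸ Ideal.span {v3 k 0}) →ₗ[R3 k] R3 k :=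
  Submodule.liftQ _ (LinearMap.toSpanSingleton (R3 k) _ (v3 k 1)) (by
    rw [Ideal.span, Submodule.span_le, Set.singleton_subset_iff]
    exact v3_zero_mul_one k)

/-- The map `ker (combine) → R` given by the retraction followed by multiplication by `x₂` does
not extend to `R²`. -/
lemma not_exists_extension :
    ¬ ∃ g : R3 k × R3 k →ₗ[R3 k] R3 k,
      g ∘ₗ (LinearMap.ker (combine k)).subtype = mulSndQuot k ∘ₗ koszulRetract k := by
  rintro ⟨g, hg⟩
  have hx : (0, v3 k 0) ∈ LinearMap.ker (combine k) :=
    (mem_ker_combine k).2 (by linear_combination v3_zero_mul_two k)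
  have h₁ : v3 k 0 * g (0, 1) = 0 := by
    rw [← smul_eq_mul, ← map_smul, Prod.smul_mk, smul_zero, smul_eq_mul, mul_one]
    refine (LinearMap.congr_fun hg ⟨_, hx⟩).trans ?_
    change mulSndQuot k (Submodule.Quotient.mk (Ideal.Quotient.mk (I3 k) (koszulCoeff k _))) = 0
    rw [koszulCoeff_eq k (c := 0) (by simp)]
    simp
  have h₂ : v3 k 2 * g (1, 0) - v3 k 1 * g (0, 1) = v3 k 1 := by
    have h := LinearMap.congr_fun hg (koszulElt k)
    rw [LinearMap.comp_apply, LinearMap.comp_apply, koszulRetract_koszulElt] at h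
    have h' : g (v3 k 2, -v3 k 1) = v3 k 1 := h.trans (one_smul (R3 k) (v3 k 1))
    rw [← smul_eq_mul, ← smul_eq_mul, ← map_smul, ← map_smul, ← map_sub]
    simpa using h'
  have h₃ := congrArg (killFst k) h₂
  simp only [map_sub, map_mul, killFst_two, killFst_one] at h₃
  obtain ⟨c, hc, -⟩ := exists_koszul (a := -(1 + killFst k (g (0, 1)))) (b := killFst k (g (1, 0)))
    (by linear_combination h₃)
  have h₄ := congrArg constantCoeff hc
  simp [constantCoeff_killFst, killRest_eq_zero h₁] at h₄

end Syzygies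

lemma nontrivial_ext_of_nontrivial_ext_ker {k : Type*} [Field k] (n : ℕ)
    (h : Nontrivial (Abelian.Ext (ModuleCat.of (R3 k) (Ideal.span {v3 k 1, v3 k 2}))
      (ModuleCat.of (R3 k) (R3 k)) (n + 1))) :
    Nontrivial (Abelian.Ext (ModuleCat.of (R3 k) (R3 k ⧸ Ideal.span {v3 k 0}))
      (ModuleCat.of (R3 k) (R3 k)) (n + 3)) := by
  have h₁ := nontrivial_ext_of_syzygy _ (Submodule.subtype_injective _) (mulFst_surjective k)
    (exact_mulFst k) n h
  exact nontrivial_ext_of_syzygy _ (Submodule.subtype_injective _)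
    (Submodule.mkQ_surjective (Ideal.span {v3 k 0})) (LinearMap.exact_subtype_mkQ _) (n + 1) h₁

lemma nontrivial_ext_three_mul {k : Type*} [Field k] (j : ℕ) :
    Nontrivial (Abelian.Ext (ModuleCat.of (R3 k) (R3 k ⧸ Ideal.span {v3 k 0}))
      (ModuleCat.of (R3 k) (R3 k)) (3 * j + 3)) := by
  induction j with
  | zero =>
    refine nontrivial_ext_of_nontrivial_ext_ker 0 ?_
    by_contra hs
    rw [not_nontrivial_iff_subsingleton] at hs
    exact not_exists_extension k (exists_extension_of_subsingleton_ext_one _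
      (Submodule.subtype_injective _) (combine_surjective k) (LinearMap.exact_subtype_ker_map _)
      hs _)
  | succ j ih =>
    refine nontrivial_ext_of_nontrivial_ext_ker (3 * j + 3) ?_
    exact nontrivial_ext_of_syzygy _ (Submodule.subtype_injective _) (combine_surjective k)
      (LinearMap.exact_subtype_ker_map _) (3 * j + 2)
      (nontrivial_ext_of_retract _ (koszulRetract_comp_koszulIncl k) _ ih)

/-- For `R = k[x₁,x₂,x₃]/(x₁x₂, x₁x₃)`, `Ext^i_R(R/(x₁), R) ≠ 0` for infinitely many
`i > 0`; hence the injective dimension of `R` as an `R`-module is infinite, i.e. for no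
`n` do all the modules `Ext^i_R(R/(x₁), R)` with `i > n` vanish. -/
theorem stmt16 (k : Type*) [Field k] :
    {i : ℕ | 0 < i ∧
      Nontrivial (((Ext (R3 k) (ModuleCat (R3 k)) i).obj
        (Opposite.op (ModuleCat.of (R3 k) (R3 k ⧸ Ideal.span {v3 k 0})))).obj
          (ModuleCat.of (R3 k) (R3 k)))}.Infinite ∧
    ¬ ∃ n : ℕ, ∀ i : ℕ, n < i →
      Subsingleton (((Ext (R3 k) (ModuleCat (R3 k)) i).obj
        (Opposite.op (ModuleCat.of (R3 k) (R3 k ⧸ Ideal.span {v3 k 0})))).obj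
          (ModuleCat.of (R3 k) (R3 k))) := by
  have key (j : ℕ) := nontrivial_ext_succ_of_abelian _ _ _ (nontrivial_ext_three_mul (k := k) j)
  refine ⟨Set.infinite_of_forall_exists_gt fun n ↦ ⟨3 * n + 3, ⟨by omega, key n⟩, by omega⟩, ?_⟩
  rintro ⟨n, hn⟩
  exact not_subsingleton_iff_nontrivial.2 (key n) (hn (3 * n + 3) (by omega))

end
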